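/- Define τ, q, r, u₀ : ℤ × ℝ² → ℝ by τ(n,t₁,t₂) = 6^n·e^{5t₁+13t₂} + 2^n·e^{3t₁+5t₂} + 4·3^n·e^{4t₁+10t₂}, q(n,t₁,t₂) = 4·6^n·e^{6t₁+14t₂} / τ(n,t₁,t₂), r(n,t₁,t₂) = ( 3^{n+1}·e^{4t₂} + 2^{n+1}·e^{−t₁−t₂} + e^{−2t₁−4t₂} ) / ( 6^{n+1}·e^{2t₁+8t₂} + 4·3^{n+1}·e^{t₁+5t₂} + 2^{n+1} ), and u₀(n,t₁,t₂) = 2·( 2·72^n·e^{4t₁+16t₂} + 4·18^n·e^{2t₁+10t₂} + 2·24^n·e^{2t₁+8t₂} + 12·54^n·e^{4t₁+18t₂} + 12^n·e^{t₁+5t₂} + 3·108^n·e^{5t₁+21t₂} + 12·36^n·e^{3t₁+13t₂} ) / ( ( 3·6^n·e^{2t₁+8t₂} + 6·3^n·e^{t₁+5t₂} + 2^n )·( 6^n·e^{2t₁+8t₂} + 4·3^n·e^{t₁+5t₂} + 2^n )² ). Then τ > 0 everywhere, and for all (n,t₁,t₂): u₀(n,t₁,t₂) = ∂_{t₁} log(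 τ(n+1,t₁,t₂) / τ(n,t₁,t₂) ) and q(n,t₁,t₂)·r(n−1,t₁,t₂) = ∂²_{t₁} log τ(n,t₁,t₂). -/

import Mathlib

open Real

/-- The tau function `τ` of the (1,0,1)-gcdKP solution from the paper's Example. -/
noncomputable def tauSol (n : ℤ) (t₁ t₂ : ℝ) : ℝ :=
  (6 : ℝ) ^ n * exp (5 * t₁ + 13 * t₂) + (2 : ℝ) ^ n * exp (3 * t₁ + 5 * t₂)
    + 4 * (3 : ℝ) ^ n * exp (4 * t₁ + 10 * t₂)

/-- The solution `q` of the (1,0,1)-gcdKP hierarchy from the paper's Example. -/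
noncomputable def qSol (n : ℤ) (t₁ t₂ : ℝ) : ℝ :=
  4 * (6 : ℝ) ^ n * exp (6 * t₁ + 14 * t₂) / tauSol n t₁ t₂

/-- The solution `r` of the (1,0,1)-gcdKP hierarchy from the paper's Example. -/
noncomputable def rSol (n : ℤ) (t₁ t₂ : ℝ) : ℝ :=
  ((3 : ℝ) ^ (n + 1) * exp (4 * t₂) + (2 : ℝ) ^ (n + 1) * exp (-t₁ - t₂)
      + exp (-2 * t₁ - 4 * t₂)) /
    ((6 : ℝ) ^ (n + 1) * exp (2 * t₁ + 8 * t₂) + 4 * (3 : ℝ) ^ (n + 1) * exp (t₁ + 5 * t₂)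
      + (2 : ℝ) ^ (n + 1))

/-- The solution `u₀` of the (1,0,1)-gcdKP hierarchy from the paper's Example. -/
noncomputable def u0Sol (n : ℤ) (t₁ t₂ : ℝ) : ℝ :=
  2 * (2 * (72 : ℝ) ^ n * exp (4 * t₁ + 16 * t₂) + 4 * (18 : ℝ) ^ n * exp (2 * t₁ + 10 * t₂)
      + 2 * (24 : ℝ) ^ n * exp (2 * t₁ + 8 * t₂) + 12 * (54 : ℝ) ^ n * exp (4 * t₁ + 18 * t₂)
      + (12 : ℝ) ^ n * exp (t₁ + 5 * t₂) + 3 * (108 : ℝ) ^ n * exp (5 * t₁ + 21 * t₂)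
      + 12 * (36 : ℝ) ^ n * exp (3 * t₁ + 13 * t₂)) /
    ((3 * (6 : ℝ) ^ n * exp (2 * t₁ + 8 * t₂) + 6 * (3 : ℝ) ^ n * exp (t₁ + 5 * t₂)
        + (2 : ℝ) ^ n)
      * ((6 : ℝ) ^ n * exp (2 * t₁ + 8 * t₂) + 4 * (3 : ℝ) ^ n * exp (t₁ + 5 * t₂)
        + (2 : ℝ) ^ n) ^ 2)

theorem tauSol_pos (n : ℤ) (t₁ t₂ : ℝ) : 0 < tauSol n t₁ t₂ := by
  unfold tauSol
  positivity

/-- The first derivative of `tauSol` in `t₁`. -/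
noncomputable def tauSolDeriv (n : ℤ) (t₁ t₂ : ℝ) : ℝ :=
  5 * (6 : ℝ) ^ n * exp (5 * t₁ + 13 * t₂) + 3 * (2 : ℝ) ^ n * exp (3 * t₁ + 5 * t₂)
    + 16 * (3 : ℝ) ^ n * exp (4 * t₁ + 10 * t₂)

/-- The second derivative of `tauSol` in `t₁`. -/
noncomputable def tauSolDeriv2 (n : ℤ) (t₁ t₂ : ℝ) : ℝ :=
  25 * (6 : ℝ) ^ n * exp (5 * t₁ + 13 * t₂) + 9 * (2 : ℝ) ^ n * exp (3 * t₁ + 5 * t₂)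
    + 64 * (3 : ℝ) ^ n * exp (4 * t₁ + 10 * t₂)

theorem hasDerivAt_const_mul_exp (c k d s : ℝ) :
    HasDerivAt (fun x => c * exp (k * x + d)) (c * (exp (k * s + d) * k)) s := by
  have h : HasDerivAt (fun x : ℝ => k * x + d) k s := by
    simpa using ((hasDerivAt_id s).const_mul k).add_const d
  exact h.exp.const_mul c

theorem hasDerivAt_tauSol (n : ℤ) (s t₂ : ℝ) :
    HasDerivAt (fun x => tauSol n x t₂) (tauSolDeriv n s t₂) s := by
  unfold tauSol tauSolDeriv
  refine HasDerivAt.congr_deriv (((hasDerivAt_const_mul_exp ((6 : ℝ) ^ n) 5 (13 * t₂) s).add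
    (hasDerivAt_const_mul_exp ((2 : ℝ) ^ n) 3 (5 * t₂) s)).add
    (hasDerivAt_const_mul_exp (4 * (3 : ℝ) ^ n) 4 (10 * t₂) s)) ?_
  ring

theorem hasDerivAt_tauSolDeriv (n : ℤ) (s t₂ : ℝ) :
    HasDerivAt (fun x => tauSolDeriv n x t₂) (tauSolDeriv2 n s t₂) s := by
  unfold tauSolDeriv tauSolDeriv2
  refine HasDerivAt.congr_deriv (((hasDerivAt_const_mul_exp (5 * (6 : ℝ) ^ n) 5 (13 * t₂) s).add
    (hasDerivAt_const_mul_exp (3 * (2 : ℝ) ^ n) 3 (5 * t₂) s)).add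
    (hasDerivAt_const_mul_exp (16 * (3 : ℝ) ^ n) 4 (10 * t₂) s)) ?_
  ring

theorem hasDerivAt_log_tauSol (n : ℤ) (s t₂ : ℝ) :
    HasDerivAt (fun x => Real.log (tauSol n x t₂)) (tauSolDeriv n s t₂ / tauSol n s t₂) s :=
  (hasDerivAt_tauSol n s t₂).log (tauSol_pos n s t₂).ne'

theorem exp_natCast_mul_add (k m : ℕ) (s t : ℝ) :
    exp (k * s + m * t) = exp s ^ k * exp t ^ m := by
  rw [exp_add, exp_nat_mul, exp_nat_mul]

theorem two_three_smooth_zpow (i j : ℕ) (n : ℤ) :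
    ((2 : ℝ) ^ i * 3 ^ j) ^ n = ((2 : ℝ) ^ n) ^ i * ((3 : ℝ) ^ n) ^ j := by
  rw [mul_zpow, ← zpow_natCast, ← zpow_natCast, ← zpow_natCast, ← zpow_natCast,
    zpow_comm, zpow_comm 3]

theorem six_zpow (n : ℤ) : (6 : ℝ) ^ n = (2 : ℝ) ^ n * (3 : ℝ) ^ n := by
  rw [← mul_zpow]; norm_num

theorem tauSol_eq (n : ℤ) (s t : ℝ) :
    tauSol n s t = (2 : ℝ) ^ n * (3 : ℝ) ^ n * (exp s ^ 5 * exp t ^ 13)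
      + (2 : ℝ) ^ n * (exp s ^ 3 * exp t ^ 5)
      + 4 * (3 : ℝ) ^ n * (exp s ^ 4 * exp t ^ 10) := by
  simp only [tauSol, six_zpow, ← exp_natCast_mul_add, Nat.cast_ofNat]

theorem tauSolDeriv_eq (n : ℤ) (s t : ℝ) :
    tauSolDeriv n s t = 5 * ((2 : ℝ) ^ n * (3 : ℝ) ^ n) * (exp s ^ 5 * exp t ^ 13)
      + 3 * (2 : ℝ) ^ n * (exp s ^ 3 * exp t ^ 5)
      + 16 * (3 : ℝ) ^ n * (exp s ^ 4 * exp t ^ 10) := by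
  simp only [tauSolDeriv, six_zpow, ← exp_natCast_mul_add, Nat.cast_ofNat]

theorem tauSolDeriv2_eq (n : ℤ) (s t : ℝ) :
    tauSolDeriv2 n s t = 25 * ((2 : ℝ) ^ n * (3 : ℝ) ^ n) * (exp s ^ 5 * exp t ^ 13)
      + 9 * (2 : ℝ) ^ n * (exp s ^ 3 * exp t ^ 5)
      + 64 * (3 : ℝ) ^ n * (exp s ^ 4 * exp t ^ 10) := by
  simp only [tauSolDeriv2, six_zpow, ← exp_natCast_mul_add, Nat.cast_ofNat]

theorem qSol_eq (n : ℤ) (s t : ℝ) :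
    qSol n s t = 4 * ((2 : ℝ) ^ n * (3 : ℝ) ^ n) * (exp s ^ 6 * exp t ^ 14) / tauSol n s t := by
  simp only [qSol, six_zpow, ← exp_natCast_mul_add, Nat.cast_ofNat]

theorem rSol_sub_one_eq (n : ℤ) (s t : ℝ) :
    rSol (n - 1) s t = ((3 : ℝ) ^ n * exp t ^ 4 + (2 : ℝ) ^ n * ((exp s)⁻¹ * (exp t)⁻¹)
        + (exp s ^ 2)⁻¹ * (exp t ^ 4)⁻¹) /
      ((2 : ℝ) ^ n * (3 : ℝ) ^ n * (exp s ^ 2 * exp t ^ 8)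
        + 4 * (3 : ℝ) ^ n * (exp s * exp t ^ 5) + (2 : ℝ) ^ n) := by
  have h₁ : exp (4 * t) = exp t ^ 4 := by
    rw [← exp_nat_mul, Nat.cast_ofNat]
  have h₂ : exp (-s - t) = (exp s)⁻¹ * (exp t)⁻¹ := by
    rw [sub_eq_add_neg, exp_add, exp_neg, exp_neg]
  have h₃ : exp (-2 * s - 4 * t) = (exp s ^ 2)⁻¹ * (exp t ^ 4)⁻¹ := by
    rw [sub_eq_add_neg, neg_mul, exp_add, exp_neg, exp_neg, ← exp_nat_mul, ← exp_nat_mul,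
      Nat.cast_ofNat, Nat.cast_ofNat]
  have h₄ : exp (2 * s + 8 * t) = exp s ^ 2 * exp t ^ 8 := mod_cast exp_natCast_mul_add 2 8 s t
  have h₅ : exp (s + 5 * t) = exp s * exp t ^ 5 := by
    simpa using exp_natCast_mul_add 1 5 s t
  simp only [rSol, sub_add_cancel, six_zpow, h₁, h₂, h₃, h₄, h₅]

theorem u0Sol_eq (n : ℤ) (s t : ℝ) :
    u0Sol n s t =
      tauSolDeriv (n + 1) s t / tauSol (n + 1) s t - tauSolDeriv n s t / tauSol n s t := by
  have h₁ : exp (s + 5 * t) = exp s * exp t ^ 5 := by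
    simpa using exp_natCast_mul_add 1 5 s t
  have h₂ : exp (2 * s + 8 * t) = exp s ^ 2 * exp t ^ 8 := mod_cast exp_natCast_mul_add 2 8 s t
  have h₃ : exp (2 * s + 10 * t) = exp s ^ 2 * exp t ^ 10 :=
    mod_cast exp_natCast_mul_add 2 10 s t
  have h₄ : exp (3 * s + 13 * t) = exp s ^ 3 * exp t ^ 13 :=
    mod_cast exp_natCast_mul_add 3 13 s t
  have h₅ : exp (4 * s + 16 * t) = exp s ^ 4 * exp t ^ 16 :=
    mod_cast exp_natCast_mul_add 4 16 s t
  have h₆ : exp (4 * s + 18 * t) = exp s ^ 4 * exp t ^ 18 :=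
    mod_cast exp_natCast_mul_add 4 18 s t
  have h₇ : exp (5 * s + 21 * t) = exp s ^ 5 * exp t ^ 21 :=
    mod_cast exp_natCast_mul_add 5 21 s t
  have p₁ : (72 : ℝ) ^ n = ((2 : ℝ) ^ n) ^ 3 * ((3 : ℝ) ^ n) ^ 2 := by
    rw [← two_three_smooth_zpow]; norm_num
  have p₂ : (18 : ℝ) ^ n = ((2 : ℝ) ^ n) ^ 1 * ((3 : ℝ) ^ n) ^ 2 := by
    rw [← two_three_smooth_zpow]; norm_num
  have p₃ : (24 : ℝ) ^ n = ((2 : ℝ) ^ n) ^ 3 * ((3 : ℝ) ^ n) ^ 1 := by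
    rw [← two_three_smooth_zpow]; norm_num
  have p₄ : (54 : ℝ) ^ n = ((2 : ℝ) ^ n) ^ 1 * ((3 : ℝ) ^ n) ^ 3 := by
    rw [← two_three_smooth_zpow]; norm_num
  have p₅ : (12 : ℝ) ^ n = ((2 : ℝ) ^ n) ^ 2 * ((3 : ℝ) ^ n) ^ 1 := by
    rw [← two_three_smooth_zpow]; norm_num
  have p₆ : (108 : ℝ) ^ n = ((2 : ℝ) ^ n) ^ 2 * ((3 : ℝ) ^ n) ^ 3 := by
    rw [← two_three_smooth_zpow]; norm_num
  have p₇ : (36 : ℝ) ^ n = ((2 : ℝ) ^ n) ^ 2 * ((3 : ℝ) ^ n) ^ 2 := by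
    rw [← two_three_smooth_zpow]; norm_num
  have q₂ : (2 : ℝ) ^ (n + 1) = 2 ^ n * 2 := zpow_add_one₀ (by norm_num) n
  have q₃ : (3 : ℝ) ^ (n + 1) = 3 ^ n * 3 := zpow_add_one₀ (by norm_num) n
  rw [u0Sol, tauSolDeriv_eq, tauSolDeriv_eq, tauSol_eq, tauSol_eq, h₁, h₂, h₃, h₄, h₅, h₆, h₇,
    p₁, p₂, p₃, p₄, p₅, p₆, p₇, six_zpow, q₂, q₃]
  have hx : 0 < (2 : ℝ) ^ n := by positivity
  have hy : 0 < (3 : ℝ) ^ n := by positivity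
  have ha := exp_pos s
  have hb := exp_pos t
  generalize (2 : ℝ) ^ n = x at *
  generalize (3 : ℝ) ^ n = y at *
  generalize exp s = a at *
  generalize exp t = b at *
  rw [div_sub_div _ _ (by positivity) (by positivity), div_eq_div_iff (by positivity)
    (by positivity)]
  ring

theorem qSol_mul_rSol_eq (n : ℤ) (s t : ℝ) :
    qSol n s t * rSol (n - 1) s t =
      (tauSolDeriv2 n s t * tauSol n s t - tauSolDeriv n s t * tauSolDeriv n s t)
        / tauSol n s t ^ 2 := by
  rw [qSol_eq, rSol_sub_one_eq, tauSolDeriv_eq, tauSolDeriv2_eq, tauSol_eq]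
  have hx : 0 < (2 : ℝ) ^ n := by positivity
  have hy : 0 < (3 : ℝ) ^ n := by positivity
  have ha := exp_pos s
  have hb := exp_pos t
  generalize (2 : ℝ) ^ n = x at *
  generalize (3 : ℝ) ^ n = y at *
  generalize exp s = a at *
  generalize exp t = b at *
  rw [div_mul_div_comm, div_eq_div_iff (by positivity) (by positivity)]
  field_simp
  ring

/-- `τ > 0` everywhere, `u₀ = ∂_{t₁} log(τ^{[1]}/τ)` and
`q·r^{[−1]} = ∂²_{t₁} log τ`. -/
theorem stmt18 (n : ℤ) (t₁ t₂ : ℝ) :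
    0 < tauSol n t₁ t₂ ∧
    HasDerivAt (fun s => Real.log (tauSol (n + 1) s t₂ / tauSol n s t₂))
      (u0Sol n t₁ t₂) t₁ ∧
    ∃ D : ℝ → ℝ, (∀ s : ℝ, HasDerivAt (fun s' => Real.log (tauSol n s' t₂)) (D s) s) ∧
      HasDerivAt D (qSol n t₁ t₂ * rSol (n - 1) t₁ t₂) t₁ := by
  refine ⟨tauSol_pos n t₁ t₂, ?_, fun s => tauSolDeriv n s t₂ / tauSol n s t₂,
    fun s => hasDerivAt_log_tauSol n s t₂, ?_⟩
  · rw [u0Sol_eq]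
    refine ((hasDerivAt_log_tauSol (n + 1) t₁ t₂).sub
      (hasDerivAt_log_tauSol n t₁ t₂)).congr_of_eventuallyEq (.of_forall fun s => ?_)
    exact Real.log_div (tauSol_pos _ _ _).ne' (tauSol_pos _ _ _).ne'
  · rw [qSol_mul_rSol_eq]
    exact (hasDerivAt_tauSolDeriv n t₁ t₂).div (hasDerivAt_tauSol n t₁ t₂)
      (tauSol_pos n t₁ t₂).ne'
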